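/- arXiv:2111.05569 — 3 statements merged into one kernel-verified Lean document; each statement's English description precedes it below -/
import Mathlib

section
/- Let γ ∈ [−3, 1]. There exists a constant C > 0, depending only on γ, such that for all measurable functions f, g, h : ℝ³ → ℝ, ∫_{ℝ³} ∫_{ℝ³} |v − v_*|^{γ+2} |f(v_*)| |g(v)| |h(v)| dv_* dv ≤ C · ‖f‖_{L²_5} · ‖g‖_{L²(ℝ³)} · ‖h‖_{L²_3}. -/
open MeasureTheory ENNReal

noncomputable section

/-- Japanese bracket `⟨v⟩ = (1 + |v|²)^(1/2)`. -/
def jb (v : EuclideanSpace ℝ (Fin 3)) : ℝ := (1 + ‖v‖ ^ 2) ^ ((1 : ℝ) / 2)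

/-- Weighted `L²` norm `‖⟨v⟩^l f‖_{L²(ℝ³)}` (with values in `[0,∞]`). -/
def eL2w (l : ℝ) (f : EuclideanSpace ℝ (Fin 3) → ℝ) : ℝ≥0∞ :=
  (∫⁻ v, (ENNReal.ofReal (jb v ^ l * |f v|)) ^ (2 : ℕ)) ^ ((1 : ℝ) / 2)

lemma integrableOn_ball_norm_neg_two (r : ℝ) :
    IntegrableOn (fun u : EuclideanSpace ℝ (Fin 3) => (‖u‖ ^ 2)⁻¹) (Metric.ball 0 r) := by
  rw [integrableOn_fun_norm_addHaar volume (f := fun y : ℝ => (y ^ 2)⁻¹)]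
  have h1 : IntegrableOn (fun _ : ℝ => (1 : ℝ)) (Set.Ioo 0 r) := by simp
  refine h1.congr_fun (fun y hy => ?_) measurableSet_Ioo
  have : y ≠ 0 := hy.1.ne'
  simp [this]

lemma jb_pos (v : EuclideanSpace ℝ (Fin 3)) : 0 < jb v := by unfold jb; positivity

lemma jb_sq (v : EuclideanSpace ℝ (Fin 3)) : jb v ^ 2 = 1 + ‖v‖ ^ 2 := by
  rw [jb, ← Real.sqrt_eq_rpow, Real.sq_sqrt (by positivity)]

lemma measurable_jb : Measurable jb := by unfold jb; fun_prop

lemma rpow_sq_le_of_mem_Icc {r s : ℝ} (hr : 0 ≤ r) (hs : s ∈ Set.Icc (-1 : ℝ) 3) :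
    (r ^ s) ^ 2 ≤ (Set.Iio (2 : ℝ)).indicator (fun r => (r ^ 2)⁻¹ + 1) r + r ^ 6 := by
  obtain ⟨h1, h3⟩ := hs
  rcases le_total 1 r with h | h
  · have hle : r ^ s ≤ r ^ (3 : ℝ) := Real.rpow_le_rpow_of_exponent_le h h3
    have hle' : (r ^ s) ^ 2 ≤ (r ^ (3 : ℝ)) ^ 2 := by gcongr
    have heq : (r ^ (3 : ℝ)) ^ 2 = r ^ 6 := by
      rw [show (3 : ℝ) = (3 : ℕ) by norm_num, Real.rpow_natCast]; ring
    have : 0 ≤ (Set.Iio (2 : ℝ)).indicator (fun r => (r ^ 2)⁻¹ + 1) r :=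
      Set.indicator_nonneg (fun _ _ => by positivity) _
    rw [← heq]
    exact hle'.trans (le_add_of_nonneg_left this)
  · rw [Set.indicator_of_mem (show r ∈ Set.Iio (2 : ℝ) from lt_of_le_of_lt h (by norm_num))]
    have h6 : 0 ≤ r ^ 6 := by positivity
    have h2 : 0 ≤ (r ^ 2)⁻¹ := by positivity
    rcases hr.eq_or_lt with rfl | hpos
    · have : (0 : ℝ) ^ s ≤ 1 := Real.zero_rpow_le_one s
      have : 0 ≤ (0 : ℝ) ^ s := Real.zero_rpow_nonneg s
      nlinarith
    · have hle : r ^ s ≤ r ^ (-1 : ℝ) := Real.rpow_le_rpow_of_exponent_ge hpos h h1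
      have hle' : (r ^ s) ^ 2 ≤ (r ^ (-1 : ℝ)) ^ 2 := by gcongr
      have heq : (r ^ (-1 : ℝ)) ^ 2 = (r ^ 2)⁻¹ := by rw [Real.rpow_neg_one, inv_pow]
      linarith

lemma norm_sub_pow_six_le (v w : EuclideanSpace ℝ (Fin 3)) :
    ‖v - w‖ ^ 6 ≤ 8 * jb v ^ 6 * jb w ^ 6 := by
  have h : ‖v - w‖ ^ 2 ≤ 2 * (jb v ^ 2 * jb w ^ 2) := by
    rw [jb_sq, jb_sq]
    have := norm_sub_le v w
    have : ‖v - w‖ ^ 2 ≤ (‖v‖ + ‖w‖) ^ 2 := by gcongr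
    nlinarith [sq_nonneg (‖v‖ - ‖w‖), mul_nonneg (sq_nonneg ‖v‖) (sq_nonneg ‖w‖)]
  calc ‖v - w‖ ^ 6 = (‖v - w‖ ^ 2) ^ 3 := by ring
    _ ≤ (2 * (jb v ^ 2 * jb w ^ 2)) ^ 3 := by gcongr
    _ = _ := by ring

lemma lintegral_jb_neg_four_lt_top :
    ∫⁻ w, ENNReal.ofReal ((jb w ^ 4)⁻¹) < ∞ := by
  have h := integrable_rpow_neg_one_add_norm_sq (E := EuclideanSpace ℝ (Fin 3))
    (μ := volume) (r := 4) (by simp; norm_num)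
  refine (lintegral_congr fun w => ?_).trans_lt h.lintegral_lt_top
  rw [show jb w ^ 4 = (jb w ^ 2) ^ 2 by ring, jb_sq, show (-4 / 2 : ℝ) = -((2 : ℕ) : ℝ) by norm_num,
    Real.rpow_neg (by positivity), Real.rpow_natCast]

/-- Cauchy–Schwarz for `lintegral`, with natural-number squares. -/
lemma lintegral_mul_le_sqrt_mul_sqrt {α : Type*} [MeasurableSpace α] {μ : Measure α}
    {a b : α → ℝ≥0∞} (ha : AEMeasurable a μ) (hb : AEMeasurable b μ) :
    ∫⁻ x, a x * b x ∂μ ≤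
      (∫⁻ x, a x ^ 2 ∂μ) ^ ((1 : ℝ) / 2) * (∫⁻ x, b x ^ 2 ∂μ) ^ ((1 : ℝ) / 2) := by
  have h := ENNReal.lintegral_mul_le_Lp_mul_Lq μ Real.HolderConjugate.two_two ha hb
  simpa only [Pi.mul_apply, ENNReal.rpow_two] using h

lemma exists_lintegral_kernel_sq_le {s : ℝ} (hs : s ∈ Set.Icc (-1 : ℝ) 3) :
    ∃ K : ℝ≥0∞, K ≠ ∞ ∧ ∀ v, ∫⁻ w, ENNReal.ofReal (‖v - w‖ ^ s * (jb w ^ 5)⁻¹) ^ 2 ≤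
      K * ENNReal.ofReal (jb v ^ 3) ^ 2 := by
  set φ : EuclideanSpace ℝ (Fin 3) → ℝ :=
    (Metric.ball 0 2).indicator (fun u => (‖u‖ ^ 2)⁻¹ + 1) with hφ
  have hφm : Measurable φ := Measurable.indicator (by fun_prop) measurableSet_ball
  have hφi : Integrable φ :=
    (integrable_indicator_iff measurableSet_ball).2
      ((integrableOn_ball_norm_neg_two 2).add (integrableOn_const measure_ball_lt_top.ne))
  have hφ0 (u) : 0 ≤ φ u := Set.indicator_nonneg (fun _ _ => by positivity) _
  refine ⟨(∫⁻ u, ENNReal.ofReal (φ u)) + ENNReal.ofReal 8 * ∫⁻ w, ENNReal.ofReal ((jb w ^ 4)⁻¹),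
    ENNReal.add_ne_top.2 ⟨hφi.lintegral_lt_top.ne,
      ENNReal.mul_ne_top ofReal_ne_top lintegral_jb_neg_four_lt_top.ne⟩, fun v => ?_⟩
  have hjm := measurable_jb
  have one_le_jb (w) : 1 ≤ jb w := by
    have := jb_sq w
    nlinarith [jb_pos w, sq_nonneg ‖w‖]
  have hpt (w) : (‖v - w‖ ^ s * (jb w ^ 5)⁻¹) ^ 2 ≤
      jb v ^ 6 * φ (v - w) + 8 * jb v ^ 6 * (jb w ^ 4)⁻¹ := by
    have hw := jb_pos w
    have h1 : (‖v - w‖ ^ s) ^ 2 ≤ φ (v - w) + ‖v - w‖ ^ 6 := by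
      refine (rpow_sq_le_of_mem_Icc (norm_nonneg _) hs).trans_eq ?_
      by_cases hvw : ‖v - w‖ < 2
      · rw [hφ, Set.indicator_of_mem (by simpa using hvw), Set.indicator_of_mem (by simpa using hvw)]
      · rw [hφ, Set.indicator_of_notMem (by simpa using hvw),
          Set.indicator_of_notMem (by simpa using hvw)]
    have h2 : (jb w ^ 10)⁻¹ ≤ 1 := inv_le_one_of_one_le₀ (one_le_pow₀ (one_le_jb w))
    have h3 : 1 ≤ jb v ^ 6 := one_le_pow₀ (one_le_jb v)
    calc (‖v - w‖ ^ s * (jb w ^ 5)⁻¹) ^ 2 = (‖v - w‖ ^ s) ^ 2 * (jb w ^ 10)⁻¹ := by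
          rw [mul_pow, inv_pow, ← pow_mul]
      _ ≤ (φ (v - w) + 8 * jb v ^ 6 * jb w ^ 6) * (jb w ^ 10)⁻¹ := by
          gcongr
          exact h1.trans (by gcongr; exact norm_sub_pow_six_le v w)
      _ = φ (v - w) * (jb w ^ 10)⁻¹ + 8 * jb v ^ 6 * (jb w ^ 4)⁻¹ := by
          field_simp
      _ ≤ _ := by
          rw [mul_comm (jb v ^ 6)]
          gcongr
          · exact hφ0 _
          · exact h2.trans h3
  have hv := (jb_pos v).le
  calc ∫⁻ w, ENNReal.ofReal (‖v - w‖ ^ s * (jb w ^ 5)⁻¹) ^ 2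
      ≤ ∫⁻ w, (ENNReal.ofReal (jb v ^ 6) * ENNReal.ofReal (φ (v - w)) +
          ENNReal.ofReal (8 * jb v ^ 6) * ENNReal.ofReal ((jb w ^ 4)⁻¹)) := by
        refine lintegral_mono fun w => ?_
        have hw := (jb_pos w).le
        rw [← ENNReal.ofReal_pow (by positivity), ← ENNReal.ofReal_mul (by positivity),
          ← ENNReal.ofReal_mul (by positivity), ← ENNReal.ofReal_add
            (mul_nonneg (by positivity) (hφ0 _)) (by positivity)]
        exact ENNReal.ofReal_le_ofReal (hpt w)
    _ = _ := by
        rw [lintegral_add_left (by fun_prop), lintegral_const_mul _ (by fun_prop),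
          lintegral_const_mul _ (by fun_prop),
          lintegral_sub_left_eq_self (fun u => ENNReal.ofReal (φ u)) v,
          ← ENNReal.ofReal_pow (by positivity), ENNReal.ofReal_mul (by norm_num), ← pow_mul]
        ring

/-- For `γ ∈ [-3,1]` there is `C > 0` depending only on `γ` such that for
all measurable `f, g, h : ℝ³ → ℝ`,
`∫∫ |v-v_*|^(γ+2) |f(v_*)| |g(v)| |h(v)| dv_* dv ≤ C ‖f‖_{L²_5} ‖g‖_{L²} ‖h‖_{L²_3}`. -/
theorem convolution_weight_bound_gamma_add_two (γ : ℝ) (hγ : γ ∈ Set.Icc (-3 : ℝ) 1) :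
    ∃ C : ℝ, 0 < C ∧
      ∀ f g h : EuclideanSpace ℝ (Fin 3) → ℝ,
        Measurable f → Measurable g → Measurable h →
        (∫⁻ v, ∫⁻ vs, ENNReal.ofReal (‖v - vs‖ ^ (γ + 2) * |f vs| * |g v| * |h v|)) ≤
          ENNReal.ofReal C * eL2w 5 f * eL2w 0 g * eL2w 3 h := by
  obtain ⟨h1, h2⟩ := hγ
  obtain ⟨K, hK, hker⟩ := exists_lintegral_kernel_sq_le (s := γ + 2)
    ⟨by linarith, by linarith⟩
  have hK' : K ^ ((1 : ℝ) / 2) ≠ ∞ := ENNReal.rpow_ne_top_of_nonneg (by norm_num) hK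
  refine ⟨(K ^ ((1 : ℝ) / 2)).toReal + 1, by positivity, fun f g h hf hg hh => ?_⟩
  have hjm := measurable_jb
  have hinner (v) : ∫⁻ w, ENNReal.ofReal (‖v - w‖ ^ (γ + 2) * |f w|) ≤
      K ^ ((1 : ℝ) / 2) * ENNReal.ofReal (jb v ^ 3) * eL2w 5 f := by
    calc ∫⁻ w, ENNReal.ofReal (‖v - w‖ ^ (γ + 2) * |f w|)
        = ∫⁻ w, ENNReal.ofReal (‖v - w‖ ^ (γ + 2) * (jb w ^ 5)⁻¹) *
            ENNReal.ofReal (jb w ^ (5 : ℝ) * |f w|) := by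
          refine lintegral_congr fun w => ?_
          have hw := jb_pos w
          rw [← ENNReal.ofReal_mul (by positivity), show (5 : ℝ) = (5 : ℕ) by norm_num,
            Real.rpow_natCast]
          congr 1
          field_simp
      _ ≤ _ := lintegral_mul_le_sqrt_mul_sqrt (by fun_prop) (by fun_prop)
      _ ≤ (K * ENNReal.ofReal (jb v ^ 3) ^ 2) ^ ((1 : ℝ) / 2) * eL2w 5 f := by
          unfold eL2w
          gcongr
          exact hker v
      _ = _ := by
          rw [ENNReal.mul_rpow_of_nonneg _ _ (by norm_num), ← ENNReal.rpow_two,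
            ← ENNReal.rpow_mul]
          norm_num
  calc ∫⁻ v, ∫⁻ w, ENNReal.ofReal (‖v - w‖ ^ (γ + 2) * |f w| * |g v| * |h v|)
      = ∫⁻ v, (∫⁻ w, ENNReal.ofReal (‖v - w‖ ^ (γ + 2) * |f w|)) *
          ENNReal.ofReal (|g v| * |h v|) := by
        refine lintegral_congr fun v => ?_
        rw [← lintegral_mul_const _ (by fun_prop)]
        refine lintegral_congr fun w => ?_
        rw [← ENNReal.ofReal_mul (by positivity), mul_assoc _ |g v|]
    _ ≤ ∫⁻ v, K ^ ((1 : ℝ) / 2) * eL2w 5 f * (ENNReal.ofReal (jb v ^ (0 : ℝ) * |g v|) *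
          ENNReal.ofReal (jb v ^ (3 : ℝ) * |h v|)) := by
        refine lintegral_mono fun v => ?_
        have hv := jb_pos v
        refine (mul_le_mul_left (hinner v) _).trans_eq ?_
        rw [show (3 : ℝ) = (3 : ℕ) by norm_num, Real.rpow_natCast, Real.rpow_zero, one_mul,
          ENNReal.ofReal_mul (by positivity), ENNReal.ofReal_mul (by positivity)]
        ring
    _ ≤ K ^ ((1 : ℝ) / 2) * eL2w 5 f * (eL2w 0 g * eL2w 3 h) := by
        rw [lintegral_const_mul _ (by fun_prop)]
        gcongr
        exact lintegral_mul_le_sqrt_mul_sqrt (by fun_prop) (by fun_prop)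
    _ ≤ _ := by
        rw [← mul_assoc]
        gcongr
        exact (ENNReal.ofReal_toReal hK').symm.le.trans
          (ENNReal.ofReal_le_ofReal (by linarith))
end
end

section
/- Let γ ∈ [−3, 1]. There exists a constant C > 0, depending only on γ, such that for all measurable functions f, g : ℝ³ → ℝ and every continuously differentiable function h : ℝ³ → ℝ, ∫_{ℝ³} ∫_{ℝ³} |v − v_*|^{γ+1} |f(v_*)| |g(v)| |h(v)| dv_* dv ≤ C · ‖f‖_{L²_5} · ‖g‖_{L²(ℝ³)} · ‖h‖_{H¹_3}. -/
open MeasureTheory ENNReal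

noncomputable section

/-- Weighted `L²` norm of the gradient, `‖⟨v⟩^l ∇f‖_{L²(ℝ³)}`. -/
def eL2gradw (l : ℝ) (f : EuclideanSpace ℝ (Fin 3) → ℝ) : ℝ≥0∞ :=
  (∫⁻ v, (ENNReal.ofReal (jb v ^ l * ‖gradient f v‖)) ^ (2 : ℕ)) ^ ((1 : ℝ) / 2)

/-- Weighted first-order Sobolev norm `‖f‖_{H¹_l} = ‖⟨v⟩^l f‖_{L²} + ‖⟨v⟩^l ∇f‖_{L²}`. -/
def eH1w (l : ℝ) (f : EuclideanSpace ℝ (Fin 3) → ℝ) : ℝ≥0∞ :=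
  eL2w l f + eL2gradw l f

lemma lintegral_mul_sq_le {α : Type*} [MeasurableSpace α] {μ : Measure α} {f g : α → ℝ≥0∞}
    (hf : AEMeasurable f μ) (hg : AEMeasurable g μ) :
    (∫⁻ a, f a * g a ∂μ) ^ 2 ≤ (∫⁻ a, f a ^ 2 ∂μ) * ∫⁻ a, g a ^ 2 ∂μ := by
  have h := ENNReal.lintegral_mul_le_Lp_mul_Lq μ Real.HolderConjugate.two_two hf hg
  simp only [Pi.mul_apply, ENNReal.rpow_two] at h
  have h2 := pow_le_pow_left' h 2
  rwa [mul_pow, ← ENNReal.rpow_two, ← ENNReal.rpow_two, ← ENNReal.rpow_two, ← ENNReal.rpow_mul,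
    ← ENNReal.rpow_mul, one_div_mul_cancel two_ne_zero, ENNReal.rpow_one, ENNReal.rpow_one,
    ENNReal.rpow_two] at h2

lemma enorm_le_lintegral_fderiv_smul {E : Type*} [NormedAddCommGroup E] [NormedSpace ℝ E]
    {u : E → ℝ} (hu : ContDiff ℝ 1 u) (hc : HasCompactSupport u) {x : E} (hx : x ≠ 0) :
    ‖u x‖ₑ ≤ ‖x‖ₑ * ∫⁻ s in Set.Ici (1 : ℝ), ‖fderiv ℝ u (s • x)‖ₑ := by
  have hw : HasCompactSupport (fun s : ℝ => u (s • x)) :=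
    hc.comp_isClosedEmbedding (isClosedEmbedding_smul_left hx)
  have hd : ∀ s : ℝ, HasDerivAt (fun s : ℝ => u (s • x)) (fderiv ℝ u (s • x) x) s := fun s => by
    have h1 := (hu.differentiable one_ne_zero (s • x)).hasFDerivAt
    have h2 : HasDerivAt (fun s : ℝ => s • x) x s := by
      simpa using (hasDerivAt_id s).smul_const x
    exact h1.comp_hasDerivAt s h2
  obtain ⟨R, hR⟩ := hw.isCompact.isBounded.subset_closedBall 0
  set b : ℝ := max 1 (R + 1)
  have hb : u (b • x) = 0 := by
    by_contra hne
    have h1 : b ∈ Metric.closedBall (0 : ℝ) R := hR (subset_tsupport _ hne)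
    rw [mem_closedBall_zero_iff, Real.norm_eq_abs] at h1
    have := le_abs_self b
    have := le_max_right (1 : ℝ) (R + 1)
    linarith
  have hcd : ContDiff ℝ 1 (fun s : ℝ => u (s • x)) := by fun_prop
  have h := enorm_sub_le_lintegral_deriv_of_contDiffOn_Icc (f := fun s : ℝ => u (s • x))
    (a := 1) (b := b) hcd.contDiffOn (le_max_left _ _)
  simp only [hb, one_smul, zero_sub, enorm_neg] at h
  refine h.trans ?_
  have hm : Measurable fun s : ℝ => ‖fderiv ℝ u (s • x)‖ₑ := by
    have := hu.continuous_fderiv one_ne_zero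
    exact Continuous.measurable (by fun_prop)
  rw [← lintegral_const_mul _ hm]
  refine (lintegral_mono fun s => ?_).trans (lintegral_mono_set Set.Icc_subset_Ici_self)
  rw [(hd s).deriv, mul_comm]
  exact ContinuousLinearMap.le_opENorm _ _

/-- Hardy's inequality for compactly supported functions in three dimensions. -/
lemma exists_hardy_const : ∃ K : ℝ≥0∞, K ≠ ⊤ ∧ ∀ u : EuclideanSpace ℝ (Fin 3) → ℝ,
    ContDiff ℝ 1 u → HasCompactSupport u →
    ∫⁻ x, (ENNReal.ofReal ‖x‖⁻¹ * ‖u x‖ₑ) ^ 2 ≤ K * ∫⁻ x, ‖fderiv ℝ u x‖ₑ ^ 2 := by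
  set K : ℝ≥0∞ := ∫⁻ s in Set.Ici (1 : ℝ), ENNReal.ofReal (s ^ (-(3 / 2) : ℝ)) with hK
  have hKtop : K ≠ ⊤ := by
    rw [hK, setLIntegral_congr Ioi_ae_eq_Ici.symm]
    exact (integrableOn_Ioi_rpow_of_lt (by norm_num) one_pos).lintegral_lt_top.ne
  refine ⟨K * K, ENNReal.mul_ne_top hKtop hKtop, fun u hu hc => ?_⟩
  have hDu : Continuous (fderiv ℝ u) := hu.continuous_fderiv one_ne_zero
  have hpt : ∀ᵐ x : EuclideanSpace ℝ (Fin 3), (ENNReal.ofReal ‖x‖⁻¹ * ‖u x‖ₑ) ^ 2 ≤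
      K * ∫⁻ s in Set.Ici (1 : ℝ), ENNReal.ofReal (s ^ (3 / 2 : ℝ)) *
        ‖fderiv ℝ u (s • x)‖ₑ ^ 2 := by
    filter_upwards [Measure.ae_ne volume (0 : EuclideanSpace ℝ (Fin 3))] with x hx
    have hm : Measurable fun s : ℝ => ‖fderiv ℝ u (s • x)‖ₑ :=
      Continuous.measurable (by fun_prop)
    have h1 : ENNReal.ofReal ‖x‖⁻¹ * ‖u x‖ₑ ≤
        ∫⁻ s in Set.Ici (1 : ℝ), ‖fderiv ℝ u (s • x)‖ₑ := by
      refine (mul_le_mul_right (enorm_le_lintegral_fderiv_smul hu hc hx) _).trans_eq ?_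
      rw [← mul_assoc, ← ofReal_norm, ← ENNReal.ofReal_mul (by positivity),
        inv_mul_cancel₀ (norm_ne_zero_iff.2 hx), ENNReal.ofReal_one, one_mul]
    have h2 : ∫⁻ s in Set.Ici (1 : ℝ), ‖fderiv ℝ u (s • x)‖ₑ =
        ∫⁻ s in Set.Ici (1 : ℝ), ENNReal.ofReal (s ^ (-(3 / 4) : ℝ)) *
          (ENNReal.ofReal (s ^ (3 / 4 : ℝ)) * ‖fderiv ℝ u (s • x)‖ₑ) := by
      refine setLIntegral_congr_fun measurableSet_Ici fun s hs => ?_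
      have hs0 : (0 : ℝ) < s := one_pos.trans_le hs
      rw [← mul_assoc, ← ENNReal.ofReal_mul (by positivity), ← Real.rpow_add hs0]
      norm_num
    refine (pow_le_pow_left' (h1.trans_eq h2) 2).trans
      ((lintegral_mul_sq_le (by fun_prop) (by fun_prop)).trans_eq ?_)
    congr 1
    · refine setLIntegral_congr_fun measurableSet_Ici fun s hs => ?_
      have hs0 : (0 : ℝ) < s := one_pos.trans_le hs
      rw [← ENNReal.ofReal_pow (by positivity), ← Real.rpow_mul_natCast hs0.le]
      norm_num
    · refine setLIntegral_congr_fun measurableSet_Ici fun s hs => ?_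
      have hs0 : (0 : ℝ) < s := one_pos.trans_le hs
      rw [mul_pow, ← ENNReal.ofReal_pow (by positivity), ← Real.rpow_mul_natCast hs0.le]
      norm_num
  refine (lintegral_mono_ae hpt).trans ?_
  rw [lintegral_const_mul' _ _ hKtop, mul_assoc]
  gcongr
  rw [lintegral_lintegral_swap (by fun_prop), hK, ← lintegral_mul_const _ (by fun_prop)]
  refine (setLIntegral_congr_fun measurableSet_Ici fun s hs => ?_).le
  have hs0 : (0 : ℝ) < s := one_pos.trans_le hs
  rw [lintegral_const_mul' _ _ ENNReal.ofReal_ne_top]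
  have hmap := lintegral_map (μ := (volume : Measure (EuclideanSpace ℝ (Fin 3))))
    (f := fun x => ‖fderiv ℝ u x‖ₑ ^ 2) (g := fun x => s • x) (by fun_prop) (by fun_prop)
  rw [← hmap, Measure.map_addHaar_smul _ hs0.ne', lintegral_smul_measure, smul_eq_mul,
    ← mul_assoc, ← ENNReal.ofReal_mul (by positivity), finrank_euclideanSpace_fin,
    abs_of_pos (by positivity), ← Real.rpow_natCast, ← Real.rpow_neg hs0.le, ← Real.rpow_add hs0]
  norm_num
lemma add_sq_le_four_mul (a b : ℝ≥0∞) : (a + b) ^ 2 ≤ 4 * (a ^ 2 + b ^ 2) := by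
  wlog hab : a ≤ b generalizing a b
  · rw [add_comm a, add_comm (a ^ 2)]
    exact this b a (le_of_not_ge hab)
  calc (a + b) ^ 2 ≤ (2 * b) ^ 2 := by
        rw [two_mul]; gcongr
    _ = 4 * b ^ 2 := by rw [mul_pow]; norm_num
    _ ≤ 4 * (a ^ 2 + b ^ 2) := by gcongr; exact le_add_self

/-- Localized form of Hardy's inequality, without support assumption. -/
lemma exists_local_hardy_const : ∃ K : ℝ≥0∞, K ≠ ⊤ ∧ ∀ h : EuclideanSpace ℝ (Fin 3) → ℝ,
    ContDiff ℝ 1 h →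
    ∫⁻ x in Metric.ball 0 1, (ENNReal.ofReal ‖x‖⁻¹ * ‖h x‖ₑ) ^ 2 ≤
      K * ((∫⁻ x, ‖h x‖ₑ ^ 2) + ∫⁻ x, ‖fderiv ℝ h x‖ₑ ^ 2) := by
  obtain ⟨K, hK, hardy⟩ := exists_hardy_const
  let χ : ContDiffBump (0 : EuclideanSpace ℝ (Fin 3)) := ⟨1, 2, one_pos, one_lt_two⟩
  have hχ : ContDiff ℝ 1 χ := χ.contDiff
  obtain ⟨M, hM⟩ := (χ.hasCompactSupport.fderiv ℝ).exists_bound_of_continuous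
    (hχ.continuous_fderiv one_ne_zero)
  set m : ℝ≥0∞ := ENNReal.ofReal M
  have hm : m ≠ ⊤ := ENNReal.ofReal_ne_top
  refine ⟨K * (4 * (m ^ 2 + 1)), by finiteness, fun h hh => ?_⟩
  have hDh : Continuous (fderiv ℝ h) := hh.continuous_fderiv one_ne_zero
  have hh0 := hh.continuous
  calc ∫⁻ x in Metric.ball 0 1, (ENNReal.ofReal ‖x‖⁻¹ * ‖h x‖ₑ) ^ 2
      = ∫⁻ x in Metric.ball 0 1, (ENNReal.ofReal ‖x‖⁻¹ * ‖χ x * h x‖ₑ) ^ 2 := by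
        refine setLIntegral_congr_fun Metric.isOpen_ball.measurableSet fun x hx => ?_
        have : χ x = 1 := χ.one_of_mem_closedBall (Metric.ball_subset_closedBall hx)
        simp [this]
    _ ≤ ∫⁻ x, (ENNReal.ofReal ‖x‖⁻¹ * ‖χ x * h x‖ₑ) ^ 2 := setLIntegral_le_lintegral _ _
    _ ≤ K * ∫⁻ x, ‖fderiv ℝ (fun x => χ x * h x) x‖ₑ ^ 2 :=
        hardy _ (hχ.mul hh) χ.hasCompactSupport.mul_right
    _ ≤ K * ∫⁻ x, 4 * (m ^ 2 + 1) * (‖h x‖ₑ ^ 2 + ‖fderiv ℝ h x‖ₑ ^ 2) := by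
        gcongr with x
        rw [fderiv_fun_mul (hχ.differentiable one_ne_zero x) (hh.differentiable one_ne_zero x)]
        have h1 : ‖χ x • fderiv ℝ h x + h x • fderiv ℝ χ x‖ₑ ≤
            ‖fderiv ℝ h x‖ₑ + m * ‖h x‖ₑ := by
          refine (enorm_add_le (χ x • fderiv ℝ h x) (h x • fderiv ℝ χ x)).trans ?_
          rw [enorm_smul, enorm_smul, mul_comm m]
          have e1 : ‖χ x‖ₑ ≤ 1 := by
            rw [Real.enorm_eq_ofReal χ.nonneg]
            exact ENNReal.ofReal_le_one.2 χ.le_one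
          have e2 : ‖fderiv ℝ χ x‖ₑ ≤ m := by
            rw [← ofReal_norm]
            exact ENNReal.ofReal_le_ofReal (hM x)
          gcongr
          exact mul_le_of_le_one_left' e1
        refine (pow_le_pow_left' h1 2).trans ((add_sq_le_four_mul _ _).trans ?_)
        rw [mul_assoc, mul_pow]
        gcongr
        rw [add_mul, mul_add, one_mul, add_comm]
        gcongr
        · exact le_self_add
        · exact le_add_self
    _ = K * (4 * (m ^ 2 + 1)) * ((∫⁻ x, ‖h x‖ₑ ^ 2) + ∫⁻ x, ‖fderiv ℝ h x‖ₑ ^ 2) := by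
        rw [lintegral_const_mul' _ _ (by finiteness), lintegral_add_left (by fun_prop), mul_assoc K]

lemma setLIntegral_ball_inv_norm_sq_ne_top :
    ∫⁻ x : EuclideanSpace ℝ (Fin 3) in Metric.ball 0 1, ENNReal.ofReal ‖x‖⁻¹ ^ 2 ≠ ⊤ := by
  obtain ⟨K, hK, hardy⟩ := exists_hardy_const
  let χ : ContDiffBump (0 : EuclideanSpace ℝ (Fin 3)) := ⟨1, 2, one_pos, one_lt_two⟩
  have hχ : ContDiff ℝ 1 χ := χ.contDiff
  have hfin : ∫⁻ x, ‖fderiv ℝ χ x‖ₑ ^ 2 ≠ ⊤ := by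
    have hc := hχ.continuous_fderiv one_ne_zero
    have := (hc.memLp_of_hasCompactSupport (p := 2) (μ := volume)
      (χ.hasCompactSupport.fderiv ℝ)).2
    rw [eLpNorm_lt_top_iff_lintegral_rpow_enorm_lt_top (by norm_num) (by norm_num)] at this
    simpa using this.ne
  refine ne_top_of_le_ne_top (ENNReal.mul_ne_top hK hfin)
    (le_trans ?_ (hardy χ hχ χ.hasCompactSupport))
  refine le_trans (le_of_eq ?_) (setLIntegral_le_lintegral (Metric.ball 0 1) _)
  refine setLIntegral_congr_fun Metric.isOpen_ball.measurableSet fun x hx => ?_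
  have : χ x = 1 := χ.one_of_mem_closedBall (Metric.ball_subset_closedBall hx)
  simp [this]

/-- The function `|x|⁻¹` cut off outside the open unit ball. -/
def truncInvNorm (x : EuclideanSpace ℝ (Fin 3)) : ℝ≥0∞ :=
  (Metric.ball 0 1).indicator (fun x => ENNReal.ofReal ‖x‖⁻¹) x

lemma measurable_truncInvNorm : Measurable truncInvNorm :=
  Measurable.indicator (by fun_prop) Metric.isOpen_ball.measurableSet

lemma exists_singular_bound : ∃ K : ℝ≥0∞, K ≠ ⊤ ∧ ∀ F G : EuclideanSpace ℝ (Fin 3) → ℝ≥0∞,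
    ∀ h : EuclideanSpace ℝ (Fin 3) → ℝ, Measurable F → Measurable G → ContDiff ℝ 1 h →
    (∫⁻ v, ∫⁻ w, truncInvNorm (v - w) ^ 2 * (F w * G v * ‖h v‖ₑ)) ^ 2 ≤
      K * (∫⁻ w, F w ^ 2) * (∫⁻ v, G v ^ 2) *
        ((∫⁻ v, ‖h v‖ₑ ^ 2) + ∫⁻ v, ‖fderiv ℝ h v‖ₑ ^ 2) := by
  obtain ⟨K, hK, hardy⟩ := exists_local_hardy_const
  have hk := measurable_truncInvNorm
  have hball : MeasurableSet (Metric.ball (0 : EuclideanSpace ℝ (Fin 3)) 1) :=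
    Metric.isOpen_ball.measurableSet
  set k₀ : ℝ≥0∞ := ∫⁻ x, truncInvNorm x ^ 2 with hk₀
  have hk₀top : k₀ ≠ ⊤ := by
    convert setLIntegral_ball_inv_norm_sq_ne_top using 1
    rw [hk₀, ← lintegral_indicator hball]
    congr 1 with x
    by_cases hx : x ∈ Metric.ball (0 : EuclideanSpace ℝ (Fin 3)) 1 <;> simp [truncInvNorm, hx]
  refine ⟨K * k₀, ENNReal.mul_ne_top hK hk₀top, fun F G h hF hG hh => ?_⟩
  have hhm : Measurable h := hh.continuous.measurable
  have hsplit : ∫⁻ v, ∫⁻ w, truncInvNorm (v - w) ^ 2 * (F w * G v * ‖h v‖ₑ) =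
      ∫⁻ p : EuclideanSpace ℝ (Fin 3) × EuclideanSpace ℝ (Fin 3),
        (truncInvNorm (p.1 - p.2) * G p.1) *
          (truncInvNorm (p.1 - p.2) * (F p.2 * ‖h p.1‖ₑ)) := by
    rw [Measure.volume_eq_prod, lintegral_prod _ (by fun_prop)]
    congr 1 with v
    congr 1 with w
    ring
  have hleft : ∫⁻ p : EuclideanSpace ℝ (Fin 3) × EuclideanSpace ℝ (Fin 3),
      (truncInvNorm (p.1 - p.2) * G p.1) ^ 2 = k₀ * ∫⁻ v, G v ^ 2 := by
    rw [Measure.volume_eq_prod, lintegral_prod _ (by fun_prop),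
      ← lintegral_const_mul _ (by fun_prop)]
    congr 1 with v
    simp_rw [mul_pow]
    rw [lintegral_mul_const _ (by fun_prop),
      lintegral_sub_left_eq_self (fun x => truncInvNorm x ^ 2) v]
  have hright : ∫⁻ p : EuclideanSpace ℝ (Fin 3) × EuclideanSpace ℝ (Fin 3),
      (truncInvNorm (p.1 - p.2) * (F p.2 * ‖h p.1‖ₑ)) ^ 2 ≤
        (∫⁻ w, F w ^ 2) * (K * ((∫⁻ v, ‖h v‖ₑ ^ 2) + ∫⁻ v, ‖fderiv ℝ h v‖ₑ ^ 2)) := by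
    rw [Measure.volume_eq_prod, lintegral_prod_symm _ (by fun_prop),
      ← lintegral_mul_const _ (by fun_prop)]
    gcongr with w
    have e1 : ∀ v, (truncInvNorm (v - w) * (F w * ‖h v‖ₑ)) ^ 2 =
        F w ^ 2 * (truncInvNorm (v - w) * ‖h v‖ₑ) ^ 2 := fun v => by ring
    simp_rw [e1]
    rw [lintegral_const_mul _ (by fun_prop)]
    gcongr
    have e2 := hardy (fun x => h (x + w)) (by fun_prop)
    simp only [fderiv_comp_add_right] at e2
    rw [lintegral_add_right_eq_self (fun x => ‖h x‖ₑ ^ 2) w,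
      lintegral_add_right_eq_self (fun x => ‖fderiv ℝ h x‖ₑ ^ 2) w,
      ← lintegral_indicator hball] at e2
    rw [← lintegral_add_right_eq_self _ w]
    refine (le_of_eq ?_).trans e2
    congr 1 with x
    by_cases hx : x ∈ Metric.ball (0 : EuclideanSpace ℝ (Fin 3)) 1 <;> simp [truncInvNorm, hx]
  rw [hsplit]
  refine (lintegral_mul_sq_le (by fun_prop) (by fun_prop)).trans ?_
  rw [hleft]
  refine (mul_le_mul_right hright _).trans_eq ?_
  ring

lemma one_le_jb (v : EuclideanSpace ℝ (Fin 3)) : 1 ≤ jb v :=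
  Real.one_le_rpow (by nlinarith [sq_nonneg ‖v‖]) (by norm_num)

lemma continuous_jb : Continuous jb := by
  unfold jb
  exact Continuous.rpow_const (by fun_prop) fun v => Or.inl (by positivity)

lemma norm_sub_rpow_le_of_one_le {a : ℝ} (ha : a ≤ 2) {v w : EuclideanSpace ℝ (Fin 3)}
    (h : 1 ≤ ‖v - w‖) : ‖v - w‖ ^ a ≤ 2 * (jb v ^ 2 * jb w ^ 2) := by
  have h1 : ‖v - w‖ ^ a ≤ ‖v - w‖ ^ 2 := by
    rw [← Real.rpow_two]
    exact Real.rpow_le_rpow_of_exponent_le h ha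
  have h2 := norm_sub_le v w
  rw [jb_sq, jb_sq]
  nlinarith [norm_nonneg (v - w), sq_nonneg (‖v‖ - ‖w‖), mul_nonneg (sq_nonneg ‖v‖) (sq_nonneg ‖w‖)]

lemma ofReal_norm_sub_rpow_le {a : ℝ} (ha : -2 ≤ a) (ha' : a ≤ 2)
    (v w : EuclideanSpace ℝ (Fin 3)) :
    ENNReal.ofReal (‖v - w‖ ^ a) ≤ truncInvNorm (v - w) ^ 2 +
      2 * (ENNReal.ofReal (jb v) ^ 2 * ENNReal.ofReal (jb w) ^ 2) := by
  have hv := one_le_jb v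
  have hw := one_le_jb w
  have hJ : 2 * (ENNReal.ofReal (jb v) ^ 2 * ENNReal.ofReal (jb w) ^ 2) =
      ENNReal.ofReal (2 * (jb v ^ 2 * jb w ^ 2)) := by
    rw [ENNReal.ofReal_mul (by norm_num), ENNReal.ofReal_mul (by positivity),
      ENNReal.ofReal_pow (by positivity), ENNReal.ofReal_pow (by positivity), ENNReal.ofReal_ofNat]
  rw [hJ]
  rcases le_or_gt 1 ‖v - w‖ with h | h
  · exact (ENNReal.ofReal_le_ofReal (norm_sub_rpow_le_of_one_le ha' h)).trans le_add_self
  rcases (norm_nonneg (v - w)).eq_or_lt with h0 | h0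
  · refine (ENNReal.ofReal_le_ofReal ?_).trans le_add_self
    rw [← h0]
    have h1 : (1 : ℝ) ≤ jb v ^ 2 * jb w ^ 2 :=
      one_le_mul_of_one_le_of_one_le (one_le_pow₀ hv) (one_le_pow₀ hw)
    rcases eq_or_ne a 0 with rfl | hne
    · rw [Real.rpow_zero]; linarith
    · rw [Real.zero_rpow hne]; linarith
  · refine le_trans ?_ le_self_add
    have hb : v - w ∈ Metric.ball (0 : EuclideanSpace ℝ (Fin 3)) 1 := by simpa using h
    rw [truncInvNorm, Set.indicator_of_mem hb, ← ENNReal.ofReal_pow (by positivity)]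
    refine ENNReal.ofReal_le_ofReal ?_
    rw [inv_pow, ← Real.rpow_two, ← Real.rpow_neg h0.le]
    exact Real.rpow_le_rpow_of_exponent_ge h0 h.le ha

lemma lintegral_jb_rpow_ne_top : ∫⁻ v, ENNReal.ofReal (jb v ^ (-3 : ℝ)) ^ 2 ≠ ⊤ := by
  have h := integrable_rpow_neg_one_add_norm_sq (μ := (volume : Measure (EuclideanSpace ℝ (Fin 3))))
    (r := 6) (by rw [finrank_euclideanSpace_fin]; norm_num)
  convert h.lintegral_lt_top.ne using 1
  congr 1 with v
  have hv := one_le_jb v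
  rw [← ENNReal.ofReal_pow (by positivity), jb, ← Real.rpow_mul (by positivity),
    ← Real.rpow_mul_natCast (by positivity)]
  norm_num

lemma eL2w_sq (l : ℝ) (f : EuclideanSpace ℝ (Fin 3) → ℝ) :
    eL2w l f ^ 2 = ∫⁻ v, (ENNReal.ofReal (jb v ^ l) * ‖f v‖ₑ) ^ 2 := by
  rw [eL2w, ← ENNReal.rpow_two, ← ENNReal.rpow_mul, one_div_mul_cancel two_ne_zero,
    ENNReal.rpow_one]
  congr 1 with v
  have hv := one_le_jb v
  rw [ENNReal.ofReal_mul (by positivity), ← Real.norm_eq_abs, ofReal_norm]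

lemma eL2gradw_sq (l : ℝ) (f : EuclideanSpace ℝ (Fin 3) → ℝ) :
    eL2gradw l f ^ 2 = ∫⁻ v, (ENNReal.ofReal (jb v ^ l) * ‖fderiv ℝ f v‖ₑ) ^ 2 := by
  rw [eL2gradw, ← ENNReal.rpow_two, ← ENNReal.rpow_mul, one_div_mul_cancel two_ne_zero,
    ENNReal.rpow_one]
  congr 1 with v
  have hv := one_le_jb v
  rw [ENNReal.ofReal_mul (by positivity), gradient, LinearIsometryEquiv.norm_map, ofReal_norm]

lemma lintegral_enorm_sq_le {F : Type*} [NormedAddCommGroup F] {l : ℝ} (hl : 0 ≤ l)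
    (f : EuclideanSpace ℝ (Fin 3) → F) :
    ∫⁻ v, ‖f v‖ₑ ^ 2 ≤ ∫⁻ v, (ENNReal.ofReal (jb v ^ l) * ‖f v‖ₑ) ^ 2 := by
  gcongr with v
  refine le_mul_of_one_le_left' ?_
  exact ENNReal.one_le_ofReal.2 (Real.one_le_rpow (one_le_jb v) hl)

lemma exists_regular_bound : ∃ K : ℝ≥0∞, K ≠ ⊤ ∧ ∀ f g h : EuclideanSpace ℝ (Fin 3) → ℝ,
    Measurable f → Measurable g → Measurable h →
    (∫⁻ v, ∫⁻ w, 2 * (ENNReal.ofReal (jb v) ^ 2 * ENNReal.ofReal (jb w) ^ 2) *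
      (‖f w‖ₑ * ‖g v‖ₑ * ‖h v‖ₑ)) ^ 2 ≤ K * (eL2w 5 f * eL2w 0 g * eL2w 3 h) ^ 2 := by
  refine ⟨4 * ∫⁻ v, ENNReal.ofReal (jb v ^ (-3 : ℝ)) ^ 2,
    ENNReal.mul_ne_top (by norm_num) lintegral_jb_rpow_ne_top, fun f g h hf hg hh => ?_⟩
  have hj := measurable_jb
  have hsplit : ∫⁻ v, ∫⁻ w, 2 * (ENNReal.ofReal (jb v) ^ 2 * ENNReal.ofReal (jb w) ^ 2) *
      (‖f w‖ₑ * ‖g v‖ₑ * ‖h v‖ₑ) =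
      2 * (∫⁻ w, ENNReal.ofReal (jb w ^ (-3 : ℝ)) * (ENNReal.ofReal (jb w ^ (5 : ℝ)) * ‖f w‖ₑ)) *
        ∫⁻ v, ‖g v‖ₑ * (ENNReal.ofReal (jb v) ^ 2 * ‖h v‖ₑ) := by
    rw [← lintegral_const_mul _ (by fun_prop), ← lintegral_const_mul _ (by fun_prop)]
    congr 1 with v
    rw [← lintegral_mul_const _ (by fun_prop)]
    congr 1 with w
    have hw : 0 < jb w := one_pos.trans_le (one_le_jb w)
    have e : ENNReal.ofReal (jb w) ^ 2 =
        ENNReal.ofReal (jb w ^ (-3 : ℝ)) * ENNReal.ofReal (jb w ^ (5 : ℝ)) := by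
      rw [← ENNReal.ofReal_mul (by positivity), ← ENNReal.ofReal_pow hw.le,
        ← Real.rpow_add hw, ← Real.rpow_two]
      norm_num
    rw [e]
    ring
  have h1 := lintegral_mul_sq_le (μ := volume)
    (f := fun w => ENNReal.ofReal (jb w ^ (-3 : ℝ)))
    (g := fun w => ENNReal.ofReal (jb w ^ (5 : ℝ)) * ‖f w‖ₑ) (by fun_prop) (by fun_prop)
  have h2 := lintegral_mul_sq_le (μ := volume) (f := fun v => ‖g v‖ₑ)
    (g := fun v => ENNReal.ofReal (jb v) ^ 2 * ‖h v‖ₑ) (by fun_prop) (by fun_prop)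
  have h3 : ∫⁻ v, (ENNReal.ofReal (jb v) ^ 2 * ‖h v‖ₑ) ^ 2 ≤ eL2w 3 h ^ 2 := by
    rw [eL2w_sq]
    gcongr with v
    have hv := one_le_jb v
    rw [← ENNReal.ofReal_pow (by positivity), ← Real.rpow_two]
    exact ENNReal.ofReal_le_ofReal (Real.rpow_le_rpow_of_exponent_le hv (by norm_num))
  have h4 : ∫⁻ v, ‖g v‖ₑ ^ 2 = eL2w 0 g ^ 2 := by simp [eL2w_sq]
  rw [hsplit, mul_pow, mul_pow, mul_pow, mul_pow]
  rw [← eL2w_sq] at h1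
  rw [h4] at h2
  calc _ ≤ 2 ^ 2 * ((∫⁻ v, ENNReal.ofReal (jb v ^ (-3 : ℝ)) ^ 2) * eL2w 5 f ^ 2) *
        (eL2w 0 g ^ 2 * eL2w 3 h ^ 2) := by
        gcongr
        exact h2.trans (by gcongr)
    _ = _ := by
        rw [show (2 : ℝ≥0∞) ^ 2 = 4 by norm_num]
        ring

/-- For `γ ∈ [-3,1]` there is `C > 0` depending only on `γ` such that for
all measurable `f, g` and every `C¹` function `h`,
`∫∫ |v-v_*|^(γ+1) |f(v_*)| |g(v)| |h(v)| dv_* dv ≤ C ‖f‖_{L²_5} ‖g‖_{L²} ‖h‖_{H¹_3}`. -/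
theorem convolution_weight_bound_gamma_add_one (γ : ℝ) (hγ : γ ∈ Set.Icc (-3 : ℝ) 1) :
    ∃ C : ℝ, 0 < C ∧
      ∀ f g h : EuclideanSpace ℝ (Fin 3) → ℝ,
        Measurable f → Measurable g → ContDiff ℝ 1 h →
        (∫⁻ v, ∫⁻ vs, ENNReal.ofReal (‖v - vs‖ ^ (γ + 1) * |f vs| * |g v| * |h v|)) ≤
          ENNReal.ofReal C * eL2w 5 f * eL2w 0 g * eH1w 3 h := by
  obtain ⟨K, hK, singular⟩ := exists_singular_bound
  obtain ⟨L, hL, regular⟩ := exists_regular_bound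
  have hMtop : 4 * (K + L) ≠ ⊤ := by finiteness
  set M : ℝ≥0∞ := 4 * (K + L)
  refine ⟨M.toReal + 1, by positivity, fun f g h hf hg hh => ?_⟩
  have hhm : Measurable h := hh.continuous.measurable
  have hj := measurable_jb
  have hk := measurable_truncInvNorm
  set D : ℝ≥0∞ := eL2w 5 f * eL2w 0 g * eH1w 3 h
  have hC : M ≤ ENNReal.ofReal (M.toReal + 1) ^ 2 := by
    have h1 : 1 ≤ ENNReal.ofReal (M.toReal + 1) := ENNReal.one_le_ofReal.2 (by simp)
    calc M = ENNReal.ofReal M.toReal := (ENNReal.ofReal_toReal hMtop).symm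
      _ ≤ ENNReal.ofReal (M.toReal + 1) := ENNReal.ofReal_le_ofReal (by simp)
      _ ≤ _ := le_self_pow h1 two_ne_zero
  have hsum : ∫⁻ v, ∫⁻ w, ENNReal.ofReal (‖v - w‖ ^ (γ + 1) * |f w| * |g v| * |h v|) ≤
      (∫⁻ v, ∫⁻ w, truncInvNorm (v - w) ^ 2 * (‖f w‖ₑ * ‖g v‖ₑ * ‖h v‖ₑ)) +
      ∫⁻ v, ∫⁻ w, 2 * (ENNReal.ofReal (jb v) ^ 2 * ENNReal.ofReal (jb w) ^ 2) *
        (‖f w‖ₑ * ‖g v‖ₑ * ‖h v‖ₑ) := by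
    rw [← lintegral_add_left (Measurable.lintegral_prod_right (by fun_prop))]
    gcongr with v
    rw [← lintegral_add_left (by fun_prop)]
    gcongr with w
    rw [← add_mul, mul_assoc, mul_assoc, ENNReal.ofReal_mul (by positivity),
      ENNReal.ofReal_mul (by positivity), ENNReal.ofReal_mul (by positivity),
      ← Real.norm_eq_abs, ← Real.norm_eq_abs, ← Real.norm_eq_abs, ofReal_norm, ofReal_norm,
      ofReal_norm, mul_assoc (‖f w‖ₑ)]
    gcongr
    exact ofReal_norm_sub_rpow_le (by linarith [hγ.1]) (by linarith [hγ.2]) v w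
  have hsing : (∫⁻ v, ∫⁻ w, truncInvNorm (v - w) ^ 2 * (‖f w‖ₑ * ‖g v‖ₑ * ‖h v‖ₑ)) ^ 2 ≤
      K * D ^ 2 := by
    refine (singular (fun w => ‖f w‖ₑ) (fun v => ‖g v‖ₑ) h (by fun_prop) (by fun_prop) hh).trans ?_
    have h1 : ∫⁻ w, ‖f w‖ₑ ^ 2 ≤ eL2w 5 f ^ 2 := by
      rw [eL2w_sq]; exact lintegral_enorm_sq_le (by norm_num) f
    have h2 : ∫⁻ v, ‖g v‖ₑ ^ 2 ≤ eL2w 0 g ^ 2 := by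
      rw [eL2w_sq]; exact lintegral_enorm_sq_le le_rfl g
    have h3 : (∫⁻ v, ‖h v‖ₑ ^ 2) + ∫⁻ v, ‖fderiv ℝ h v‖ₑ ^ 2 ≤ eH1w 3 h ^ 2 := by
      calc _ ≤ eL2w 3 h ^ 2 + eL2gradw 3 h ^ 2 := by
            rw [eL2w_sq, eL2gradw_sq]
            exact add_le_add (lintegral_enorm_sq_le (by norm_num) h)
              (lintegral_enorm_sq_le (by norm_num) (fderiv ℝ h))
        _ ≤ eL2w 3 h ^ 2 + eL2gradw 3 h ^ 2 + 2 * eL2w 3 h * eL2gradw 3 h := le_self_add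
        _ = eH1w 3 h ^ 2 := by rw [eH1w]; ring
    calc _ ≤ K * eL2w 5 f ^ 2 * eL2w 0 g ^ 2 * eH1w 3 h ^ 2 := by gcongr
      _ = _ := by simp only [D]; ring
  have hreg := (regular f g h hf hg hhm).trans
    (show _ ≤ L * D ^ 2 by
      simp only [D, eH1w]
      gcongr
      exact le_self_add)
  rw [mul_assoc, mul_assoc, ← mul_assoc (eL2w 5 f), ← ENNReal.pow_le_pow_left_iff two_ne_zero]
  calc _ ≤ _ := pow_le_pow_left' hsum 2
    _ ≤ 4 * (K * D ^ 2 + L * D ^ 2) :=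
        (add_sq_le_four_mul _ _).trans (mul_le_mul_right (add_le_add hsing hreg) _)
    _ = M * D ^ 2 := by simp only [M]; ring
    _ ≤ _ := (mul_le_mul_left hC _).trans_eq (mul_pow _ _ 2).symm
end
end

section
/- Let γ ∈ [−3, −2). There exists a constant C > 0, depending only on γ, such that for every measurable function f : ℝ³ → ℝ and every continuously differentiable function h : ℝ³ → ℝ, ∫_{ℝ³} ∫_{ℝ³} |v − v_*|^{γ + 3/2} ⟨v_*⟩⁴ |f(v_*)|² |h(v)|² dv dv_* ≤ C · ‖f‖_{L²_2}² · ( ‖h‖_{L²(ℝ³)} + ‖∇h‖_{L²(ℝ³)} )². -/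
open MeasureTheory ENNReal

noncomputable section

/-- `L²` norm of the gradient, `‖∇f‖_{L²(ℝ³)}`. -/
def eL2grad (f : EuclideanSpace ℝ (Fin 3) → ℝ) : ℝ≥0∞ :=
  (∫⁻ v, (ENNReal.ofReal ‖gradient f v‖) ^ (2 : ℕ)) ^ ((1 : ℝ) / 2)

/-- Integration in polar coordinates on `ℝ³` for nonnegative functions. -/
lemma lintegral_eq_lintegral_toSphere_lintegral_Ioi {g : EuclideanSpace ℝ (Fin 3) → ℝ≥0∞}
    (hg : Measurable g) :
    ∫⁻ x, g x =
      ∫⁻ ω, (∫⁻ r in Set.Ioi (0 : ℝ),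
        ENNReal.ofReal (r ^ 2) * g (r • (ω : EuclideanSpace ℝ (Fin 3))))
        ∂(volume : Measure (EuclideanSpace ℝ (Fin 3))).toSphere := by
  have hmp := (volume : Measure (EuclideanSpace ℝ (Fin 3))).measurePreserving_homeomorphUnitSphereProd
  rw [show Module.finrank ℝ (EuclideanSpace ℝ (Fin 3)) - 1 = 2 by simp] at hmp
  have hG : Measurable fun p : Metric.sphere (0 : EuclideanSpace ℝ (Fin 3)) 1 × Set.Ioi (0 : ℝ) =>
      g ((p.2 : ℝ) • (p.1 : EuclideanSpace ℝ (Fin 3))) :=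
    hg.comp (by fun_prop)
  calc ∫⁻ x, g x
      = ∫⁻ x : ({0}ᶜ : Set (EuclideanSpace ℝ (Fin 3))), g x
          ∂(volume.comap Subtype.val) := by
        rw [lintegral_subtype_comap (measurableSet_singleton _).compl, restrict_compl_singleton]
    _ = ∫⁻ p, g ((p.2 : ℝ) • (p.1 : EuclideanSpace ℝ (Fin 3)))
          ∂((volume : Measure (EuclideanSpace ℝ (Fin 3))).toSphere.prod
            (Measure.volumeIoiPow 2)) := by
        rw [← hmp.lintegral_comp hG]
        refine lintegral_congr fun x => ?_
        have hx : ‖(x : EuclideanSpace ℝ (Fin 3))‖ ≠ 0 := norm_ne_zero_iff.2 x.2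
        simp [smul_smul, hx]
    _ = _ := by
        rw [lintegral_prod _ hG.aemeasurable]
        refine lintegral_congr fun ω => ?_
        have hω : Measurable fun r : ℝ => g (r • (ω : EuclideanSpace ℝ (Fin 3))) :=
          hg.comp (by fun_prop)
        refine (lintegral_withDensity_eq_lintegral_mul _ (by fun_prop)
          (hω.comp measurable_subtype_coe)).trans ?_
        exact lintegral_subtype_comap measurableSet_Ioi
          (fun r : ℝ => ENNReal.ofReal (r ^ 2) * g (r • (ω : EuclideanSpace ℝ (Fin 3))))

lemma sq_sub_le_div_mul_integral {φ ψ : ℝ → ℝ} (hφ : ∀ t, HasDerivAt φ (ψ t) t)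
    (hψ : Continuous ψ) {r s : ℝ} (hr : 0 < r) (hrs : r ≤ s) :
    (φ s - φ r) ^ 2 ≤ 1 / r * ∫ t in r..s, t ^ 2 * ψ t ^ 2 := by
  have hne : ∀ t ∈ Set.uIcc r s, t ≠ 0 := fun t ht => by
    rw [Set.uIcc_of_le hrs] at ht
    exact (hr.trans_le ht.1).ne'
  set K := φ s - φ r with hK
  set A := ∫ t in r..s, t ^ 2 * ψ t ^ 2 with hA
  have hφint : ∫ t in r..s, ψ t = K :=
    intervalIntegral.integral_eq_sub_of_hasDerivAt (fun t _ => hφ t) (hψ.intervalIntegrable _ _)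
  have hinvc : IntervalIntegrable (fun t : ℝ => (t ^ 2)⁻¹) volume r s :=
    ContinuousOn.intervalIntegrable (ContinuousOn.inv₀ (by fun_prop)
      fun t ht => pow_ne_zero 2 (hne t ht))
  have hinv : ∫ t in r..s, (t ^ 2)⁻¹ = r⁻¹ - s⁻¹ := by
    rw [intervalIntegral.integral_eq_sub_of_hasDerivAt (f := fun t : ℝ => -t⁻¹)
      (fun t ht => by
        simpa using (hasDerivAt_inv (hne t ht)).fun_neg) hinvc]
    ring
  have hψ2 : IntervalIntegrable (fun t => t ^ 2 * ψ t ^ 2) volume r s :=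
    Continuous.intervalIntegrable (by fun_prop) _ _
  have key : ∫ t in r..s, 2 * (r * K) * ψ t ≤
      ∫ t in r..s, ((r * K) ^ 2 * (t ^ 2)⁻¹ + t ^ 2 * ψ t ^ 2) := by
    refine intervalIntegral.integral_mono_on hrs (Continuous.intervalIntegrable (by fun_prop) _ _)
      ((hinvc.const_mul _).add hψ2) fun t ht => ?_
    have ht0 : t ≠ 0 := (hr.trans_le ht.1).ne'
    have h1 : (r * K) ^ 2 * (t ^ 2)⁻¹ + t ^ 2 * ψ t ^ 2 - 2 * (r * K) * ψ t
        = (r * K * t⁻¹ - t * ψ t) ^ 2 := by field_simp; ring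
    nlinarith [sq_nonneg (r * K * t⁻¹ - t * ψ t)]
  rw [intervalIntegral.integral_add (hinvc.const_mul _) hψ2, intervalIntegral.integral_const_mul,
    intervalIntegral.integral_const_mul, hφint, hinv] at key
  have hs : 0 ≤ (r * K) ^ 2 * s⁻¹ :=
    mul_nonneg (sq_nonneg _) (inv_nonneg.2 (hr.le.trans hrs))
  have h2 : (r * K) ^ 2 * r⁻¹ = r * K ^ 2 := by field_simp
  rw [one_div, ← div_eq_inv_mul, le_div_iff₀ hr]
  nlinarith

lemma ofReal_sq_le_add_mul_lintegral {φ ψ : ℝ → ℝ} (hφ : ∀ t, HasDerivAt φ (ψ t) t)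
    (hψ : Continuous ψ) {r s : ℝ} (hr : 0 < r) (hrs : r ≤ s) :
    ENNReal.ofReal (φ r ^ 2) ≤ 2 * ENNReal.ofReal (φ s ^ 2) +
      ENNReal.ofReal (2 / r) * ∫⁻ t in Set.Ioi (0 : ℝ), ENNReal.ofReal (t ^ 2 * ψ t ^ 2) := by
  have hsub : Set.Ioc r s ⊆ Set.Ioi 0 := fun t ht => hr.trans ht.1
  have hA : ENNReal.ofReal (∫ t in r..s, t ^ 2 * ψ t ^ 2) ≤
      ∫⁻ t in Set.Ioi (0 : ℝ), ENNReal.ofReal (t ^ 2 * ψ t ^ 2) := by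
    rw [intervalIntegral.integral_of_le hrs, ofReal_integral_eq_lintegral_ofReal
      ((Continuous.intervalIntegrable (by fun_prop) r s).1)
      (Filter.Eventually.of_forall fun t => by positivity)]
    exact lintegral_mono_set hsub
  have hle : φ r ^ 2 ≤ 2 * φ s ^ 2 + 2 / r * ∫ t in r..s, t ^ 2 * ψ t ^ 2 := by
    have h1 := sq_sub_le_div_mul_integral hφ hψ hr hrs
    have h2 : 2 / r * ∫ t in r..s, t ^ 2 * ψ t ^ 2 =
        2 * (1 / r * ∫ t in r..s, t ^ 2 * ψ t ^ 2) := by ring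
    nlinarith [sq_nonneg (φ r - 2 * φ s)]
  calc ENNReal.ofReal (φ r ^ 2)
      ≤ ENNReal.ofReal (2 * φ s ^ 2 + 2 / r * ∫ t in r..s, t ^ 2 * ψ t ^ 2) :=
        ENNReal.ofReal_le_ofReal hle
    _ ≤ ENNReal.ofReal (2 * φ s ^ 2) +
          ENNReal.ofReal (2 / r * ∫ t in r..s, t ^ 2 * ψ t ^ 2) := ENNReal.ofReal_add_le
    _ ≤ _ := by
        rw [ENNReal.ofReal_mul zero_le_two, ENNReal.ofReal_mul (by positivity : 0 ≤ 2 / r),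
          ENNReal.ofReal_ofNat]
        gcongr

lemma lintegral_Ioc_ofReal_two_mul_rpow_neg_half :
    ∫⁻ r in Set.Ioc (0 : ℝ) 1, ENNReal.ofReal (2 * r ^ (-(1 / 2) : ℝ)) = 4 := by
  have hint : IntervalIntegrable (fun r : ℝ => 2 * r ^ (-(1 / 2) : ℝ)) volume 0 1 :=
    (intervalIntegral.intervalIntegrable_rpow' (by norm_num)).const_mul 2
  rw [← ofReal_integral_eq_lintegral_ofReal hint.1
    ((ae_restrict_iff' measurableSet_Ioc).2 (Filter.Eventually.of_forall fun r hr =>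
      mul_nonneg zero_le_two (Real.rpow_nonneg hr.1.le _))),
    ← intervalIntegral.integral_of_le zero_le_one, intervalIntegral.integral_const_mul,
    integral_rpow (Or.inl (by norm_num))]
  norm_num

/-- A weighted Hardy-type inequality on the half-line. -/
lemma lintegral_Ioi_rpow_mul_sq_le {a : ℝ} (ha : -(3 / 2) ≤ a) (ha0 : a ≤ 0) {φ ψ : ℝ → ℝ}
    (hφ : ∀ t, HasDerivAt φ (ψ t) t) (hψ : Continuous ψ) :
    ∫⁻ r in Set.Ioi (0 : ℝ), ENNReal.ofReal (r ^ 2 * (r ^ a * φ r ^ 2)) ≤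
      4 * ((∫⁻ r in Set.Ioi (0 : ℝ), ENNReal.ofReal (r ^ 2 * φ r ^ 2)) +
        ∫⁻ r in Set.Ioi (0 : ℝ), ENNReal.ofReal (r ^ 2 * ψ r ^ 2)) := by
  set H := ∫⁻ r in Set.Ioi (0 : ℝ), ENNReal.ofReal (r ^ 2 * φ r ^ 2) with hH
  set D := ∫⁻ r in Set.Ioi (0 : ℝ), ENNReal.ofReal (r ^ 2 * ψ r ^ 2) with hD
  have hφc : Continuous φ := continuous_iff_continuousAt.2 fun t => (hφ t).continuousAt
  have hpt : ∀ r ∈ Set.Ioc (0 : ℝ) 1, ∀ s ∈ Set.Ioc (1 : ℝ) 2,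
      ENNReal.ofReal (r ^ 2 * (r ^ a * φ r ^ 2)) ≤
        2 * ENNReal.ofReal (s ^ 2 * φ s ^ 2) +
          ENNReal.ofReal (2 * r ^ (-(1 / 2) : ℝ)) * D := by
    intro r hr s hs
    have hw1 : r ^ 2 * r ^ a ≤ 1 := by
      rw [← Real.rpow_natCast, ← Real.rpow_add hr.1]
      exact Real.rpow_le_one hr.1.le hr.2 (by push_cast; linarith)
    have hw2 : r ^ 2 * r ^ a * (2 / r) ≤ 2 * r ^ (-(1 / 2) : ℝ) := by
      have : r ^ 2 * r ^ a * (2 / r) = 2 * r ^ (1 + a) := by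
        rw [Real.rpow_add hr.1, Real.rpow_one]
        field_simp [hr.1.ne']
      rw [this]
      exact mul_le_mul_of_nonneg_left
        (Real.rpow_le_rpow_of_exponent_ge hr.1 hr.2 (by linarith)) zero_le_two
    have hw0 : 0 ≤ r ^ 2 * r ^ a := mul_nonneg (sq_nonneg _) (Real.rpow_nonneg hr.1.le _)
    calc ENNReal.ofReal (r ^ 2 * (r ^ a * φ r ^ 2))
        = ENNReal.ofReal (r ^ 2 * r ^ a) * ENNReal.ofReal (φ r ^ 2) := by
          rw [← ENNReal.ofReal_mul hw0, mul_assoc]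
      _ ≤ ENNReal.ofReal (r ^ 2 * r ^ a) *
            (2 * ENNReal.ofReal (φ s ^ 2) + ENNReal.ofReal (2 / r) * D) := by
          gcongr
          exact ofReal_sq_le_add_mul_lintegral hφ hψ hr.1 (hr.2.trans hs.1.le)
      _ = 2 * (ENNReal.ofReal (r ^ 2 * r ^ a) * ENNReal.ofReal (φ s ^ 2)) +
            ENNReal.ofReal (r ^ 2 * r ^ a * (2 / r)) * D := by
          rw [ENNReal.ofReal_mul hw0]
          ring
      _ ≤ _ := by
          rw [← ENNReal.ofReal_mul hw0]
          gcongr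
          nlinarith [hs.1]
  have hJ : ∀ s ∈ Set.Ioc (1 : ℝ) 2,
      ∫⁻ r in Set.Ioc (0 : ℝ) 1, ENNReal.ofReal (r ^ 2 * (r ^ a * φ r ^ 2)) ≤
        2 * ENNReal.ofReal (s ^ 2 * φ s ^ 2) + 4 * D := by
    intro s hs
    refine (setLIntegral_mono' measurableSet_Ioc fun r hr => hpt r hr s hs).trans_eq ?_
    rw [lintegral_add_left measurable_const,
      lintegral_mul_const D (by fun_prop), lintegral_Ioc_ofReal_two_mul_rpow_neg_half]
    simp
  have hnear : ∫⁻ r in Set.Ioc (0 : ℝ) 1, ENNReal.ofReal (r ^ 2 * (r ^ a * φ r ^ 2)) ≤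
      2 * (∫⁻ r in Set.Ioc (1 : ℝ) 2, ENNReal.ofReal (r ^ 2 * φ r ^ 2)) + 4 * D := by
    have h := setLIntegral_mono' (μ := volume) measurableSet_Ioc hJ
    rw [lintegral_add_right _ measurable_const, lintegral_const_mul _ (by fun_prop)] at h
    norm_num at h
    exact h
  have hfar : ∫⁻ r in Set.Ioi (1 : ℝ), ENNReal.ofReal (r ^ 2 * (r ^ a * φ r ^ 2)) ≤ H := by
    refine (setLIntegral_mono' measurableSet_Ioi fun r hr => ?_).trans
      (lintegral_mono_set (Set.Ioi_subset_Ioi zero_le_one))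
    have : r ^ a ≤ 1 := Real.rpow_le_one_of_one_le_of_nonpos (le_of_lt hr) ha0
    refine ENNReal.ofReal_le_ofReal (mul_le_mul_of_nonneg_left ?_ (sq_nonneg r))
    exact mul_le_of_le_one_left (sq_nonneg _) this
  rw [← Set.Ioc_union_Ioi_eq_Ioi (zero_le_one' ℝ),
    lintegral_union measurableSet_Ioi (Set.Ioc_disjoint_Ioi le_rfl)]
  calc _ ≤ 2 * H + 4 * D + H := by
        gcongr
        refine hnear.trans ?_
        gcongr
        exact lintegral_mono_set fun t ht => zero_lt_one.trans ht.1
    _ = 3 * H + 4 * D := by ring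
    _ ≤ 4 * H + 4 * D := by gcongr; norm_num
    _ = _ := by ring

/-- The potential bound `∫ |x|^a |u|² ≤ 4 (‖u‖² + ‖∇u‖²)` in `L²(ℝ³)`. -/
lemma lintegral_norm_rpow_mul_sq_le {a : ℝ} (ha : -(3 / 2) ≤ a) (ha0 : a ≤ 0)
    {u : EuclideanSpace ℝ (Fin 3) → ℝ} (hu : ContDiff ℝ 1 u) :
    ∫⁻ x, ENNReal.ofReal (‖x‖ ^ a * u x ^ 2) ≤
      4 * ((∫⁻ x, ENNReal.ofReal (u x ^ 2)) + ∫⁻ x, ENNReal.ofReal (‖fderiv ℝ u x‖ ^ 2)) := by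
  have huc : Continuous u := hu.continuous
  have hfc : Continuous (fderiv ℝ u) := hu.continuous_fderiv one_ne_zero
  have hum : Measurable u := huc.measurable
  have hfm : Measurable fun x => ‖fderiv ℝ u x‖ := hfc.norm.measurable
  have hmf : Measurable fun x => ENNReal.ofReal (‖fderiv ℝ u x‖ ^ 2) := by fun_prop
  have hmu : Measurable fun x => ENNReal.ofReal (u x ^ 2) := by fun_prop
  rw [lintegral_eq_lintegral_toSphere_lintegral_Ioi (by fun_prop),
    lintegral_eq_lintegral_toSphere_lintegral_Ioi hmu,
    lintegral_eq_lintegral_toSphere_lintegral_Ioi hmf]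
  have hm : Measurable fun ω : Metric.sphere (0 : EuclideanSpace ℝ (Fin 3)) 1 =>
      ∫⁻ r in Set.Ioi (0 : ℝ), ENNReal.ofReal (r ^ 2) *
        ENNReal.ofReal (u (r • (ω : EuclideanSpace ℝ (Fin 3))) ^ 2) := by
    refine Measurable.lintegral_prod_right' (f := fun p : _ × ℝ => ENNReal.ofReal (p.2 ^ 2) *
      ENNReal.ofReal (u (p.2 • ((p.1 : Metric.sphere (0 : EuclideanSpace ℝ (Fin 3)) 1) :
        EuclideanSpace ℝ (Fin 3))) ^ 2)) ?_
    have : Measurable fun p : Metric.sphere (0 : EuclideanSpace ℝ (Fin 3)) 1 × ℝ =>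
      u (p.2 • (p.1 : EuclideanSpace ℝ (Fin 3))) := hum.comp (by fun_prop)
    fun_prop
  rw [← lintegral_add_left hm, ← lintegral_const_mul' _ _ (by norm_num)]
  refine lintegral_mono fun ω => ?_
  have hω : ‖(ω : EuclideanSpace ℝ (Fin 3))‖ = 1 := norm_eq_of_mem_sphere ω
  have hderiv : ∀ t : ℝ, HasDerivAt (fun t : ℝ => u (t • (ω : EuclideanSpace ℝ (Fin 3))))
      (fderiv ℝ u (t • (ω : EuclideanSpace ℝ (Fin 3))) ω) t := fun t => by
    have h1 : HasDerivAt (fun t : ℝ => t • (ω : EuclideanSpace ℝ (Fin 3))) ω t := by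
      simpa using (hasDerivAt_id t).smul_const (ω : EuclideanSpace ℝ (Fin 3))
    exact (hu.differentiable one_ne_zero _).hasFDerivAt.comp_hasDerivAt t h1
  have hcont : Continuous fun t : ℝ => fderiv ℝ u (t • (ω : EuclideanSpace ℝ (Fin 3))) ω :=
    (hfc.comp (by fun_prop)).clm_apply continuous_const
  refine le_trans (le_of_eq ?_) ((lintegral_Ioi_rpow_mul_sq_le ha ha0 hderiv hcont).trans ?_)
  · refine setLIntegral_congr_fun measurableSet_Ioi fun r hr => ?_
    rw [Set.mem_Ioi] at hr
    simp only [norm_smul, hω, mul_one, Real.norm_of_nonneg hr.le]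
    rw [← ENNReal.ofReal_mul (sq_nonneg r)]
  · gcongr with r r
    · rw [← ENNReal.ofReal_mul (sq_nonneg _)]
    · rw [← ENNReal.ofReal_mul (sq_nonneg _)]
      refine ENNReal.ofReal_le_ofReal (mul_le_mul_of_nonneg_left ?_ (sq_nonneg _))
      rw [sq_le_sq, abs_norm]
      simpa [hω] using (fderiv ℝ u (r • (ω : EuclideanSpace ℝ (Fin 3)))).le_opNorm ω

lemma lintegral_norm_sub_rpow_mul_sq_le {a : ℝ} (ha : -(3 / 2) ≤ a) (ha0 : a ≤ 0)
    {h : EuclideanSpace ℝ (Fin 3) → ℝ} (hh : ContDiff ℝ 1 h) (w : EuclideanSpace ℝ (Fin 3)) :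
    ∫⁻ v, ENNReal.ofReal (‖v - w‖ ^ a * h v ^ 2) ≤
      4 * ((∫⁻ x, ENNReal.ofReal (h x ^ 2)) + ∫⁻ x, ENNReal.ofReal (‖fderiv ℝ h x‖ ^ 2)) := by
  have key := lintegral_norm_rpow_mul_sq_le ha ha0
    (u := fun x => h (x + w)) (hh.comp (contDiff_id.add contDiff_const))
  simp only [fderiv_comp_add_right] at key
  rw [lintegral_add_right_eq_self (fun x => ENNReal.ofReal (h x ^ 2)) w,
    lintegral_add_right_eq_self (fun x => ENNReal.ofReal (‖fderiv ℝ h x‖ ^ 2)) w] at key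
  rw [← lintegral_add_right_eq_self (fun v => ENNReal.ofReal (‖v - w‖ ^ a * h v ^ 2)) w]
  simpa using key

lemma eL2w_two_sq (f : EuclideanSpace ℝ (Fin 3) → ℝ) :
    eL2w 2 f ^ 2 = ∫⁻ v, ENNReal.ofReal (jb v ^ 4 * |f v| ^ 2) := by
  rw [eL2w, ← ENNReal.rpow_natCast, ← ENNReal.rpow_mul]
  norm_num
  refine lintegral_congr fun v => ?_
  rw [← ENNReal.ofReal_pow (mul_nonneg (sq_nonneg _) (abs_nonneg _))]
  congr 1
  rw [mul_pow, sq_abs]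
  ring

lemma eL2w_zero_sq (h : EuclideanSpace ℝ (Fin 3) → ℝ) :
    eL2w 0 h ^ 2 = ∫⁻ v, ENNReal.ofReal (h v ^ 2) := by
  rw [eL2w, ← ENNReal.rpow_natCast, ← ENNReal.rpow_mul]
  norm_num
  refine lintegral_congr fun v => ?_
  rw [← ENNReal.ofReal_pow (abs_nonneg _), sq_abs]

lemma eL2grad_sq (h : EuclideanSpace ℝ (Fin 3) → ℝ) :
    eL2grad h ^ 2 = ∫⁻ v, ENNReal.ofReal (‖fderiv ℝ h v‖ ^ 2) := by
  rw [eL2grad, ← ENNReal.rpow_natCast, ← ENNReal.rpow_mul]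
  norm_num [gradient]

/-- For `γ ∈ [-3,-2)` there is `C > 0` depending only on `γ` such that for
every measurable `f` and every `C¹` function `h`,
`∫∫ |v-v_*|^(γ+3/2) ⟨v_*⟩⁴ |f(v_*)|² |h(v)|² dv dv_*
  ≤ C ‖f‖_{L²_2}² (‖h‖_{L²} + ‖∇h‖_{L²})²`. -/
theorem convolution_weight_bound_soft (γ : ℝ) (hγ : γ ∈ Set.Ico (-3 : ℝ) (-2)) :
    ∃ C : ℝ, 0 < C ∧
      ∀ f h : EuclideanSpace ℝ (Fin 3) → ℝ,
        Measurable f → ContDiff ℝ 1 h →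
        (∫⁻ vs, ∫⁻ v,
            ENNReal.ofReal (‖v - vs‖ ^ (γ + 3 / 2) * jb vs ^ (4 : ℕ) * |f vs| ^ 2 * |h v| ^ 2)) ≤
          ENNReal.ofReal C * (eL2w 2 f) ^ (2 : ℕ) * (eL2w 0 h + eL2grad h) ^ (2 : ℕ) := by
  obtain ⟨hγ3, hγ2⟩ := hγ
  refine ⟨4, by norm_num, fun f h hf hh => ?_⟩
  have hhm : Measurable h := hh.continuous.measurable
  have hjb : Measurable jb := by unfold jb; fun_prop
  set B := eL2w 0 h ^ 2 + eL2grad h ^ 2 with hB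
  have hinner : ∀ w, ∫⁻ v, ENNReal.ofReal
        (‖v - w‖ ^ (γ + 3 / 2) * jb w ^ (4 : ℕ) * |f w| ^ 2 * |h v| ^ 2) ≤
      ENNReal.ofReal (jb w ^ 4 * |f w| ^ 2) * (4 * B) := fun w => by
    have hw : 0 ≤ jb w ^ 4 * |f w| ^ 2 := by positivity
    calc _ = ∫⁻ v, ENNReal.ofReal (jb w ^ 4 * |f w| ^ 2) *
            ENNReal.ofReal (‖v - w‖ ^ (γ + 3 / 2) * h v ^ 2) := by
          refine lintegral_congr fun v => ?_
          rw [← ENNReal.ofReal_mul hw, sq_abs (h v)]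
          congr 1
          ring
      _ ≤ _ := by
          rw [lintegral_const_mul' _ _ ENNReal.ofReal_ne_top, hB, eL2w_zero_sq, eL2grad_sq]
          gcongr
          exact lintegral_norm_sub_rpow_mul_sq_le (by linarith) (by linarith) hh w
  refine (lintegral_mono hinner).trans ?_
  rw [lintegral_mul_const _ (by fun_prop), ← eL2w_two_sq, ENNReal.ofReal_ofNat]
  have hBle : B ≤ (eL2w 0 h + eL2grad h) ^ 2 := by
    rw [hB, add_sq, add_right_comm]
    exact le_self_add
  calc _ = 4 * eL2w 2 f ^ 2 * B := by ring
    _ ≤ _ := by gcongr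
end
end
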